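/- arXiv:1208.2185 — 3 statements merged into one kernel-verified Lean document; each statement's English description precedes it below -/
import Mathlib

section
/- For all a1, a2, a3, a4, a5 in F, [[a1,a2][a3,a4], a5] = 0; that is, the polynomial [[t1,t2][t3,t4],t5] is a polynomial identity of the algebra F. -/
/- STATEMENT 0: [[t1,t2][t3,t4],t5] is a polynomial identity of the algebra F = K[C1, C2]. -/

open scoped TensorProduct

noncomputable section

/-- The free supercommutative algebra on four even variables `x1, x2, x1', x2'` and four odd
variables `y1, y2, y1', y2'`: the tensor product of a polynomial ring in four variables with
the exterior algebra on a four-dimensional space. -/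
abbrev FreeSuperComm (K : Type*) [Field K] :=
  (MvPolynomial (Fin 4) K) ⊗[K] (ExteriorAlgebra K (Fin 4 → K))

/-- The even generators: `xg K 0 = x1`, `xg K 1 = x1'`, `xg K 2 = x2`, `xg K 3 = x2'`. -/
def xg (K : Type*) [Field K] (i : Fin 4) : FreeSuperComm K :=
  (MvPolynomial.X i) ⊗ₜ[K] 1

/-- The odd generators: `yg K 0 = y1`, `yg K 1 = y1'`, `yg K 2 = y2`, `yg K 3 = y2'`. -/
def yg (K : Type*) [Field K] (i : Fin 4) : FreeSuperComm K :=
  1 ⊗ₜ[K] (ExteriorAlgebra.ι K (Pi.single i 1))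

/-- The generic matrix `C1 = (x1, y1; y1', x1')`. -/
def genC₁ (K : Type*) [Field K] : Matrix (Fin 2) (Fin 2) (FreeSuperComm K) :=
  !![xg K 0, yg K 0; yg K 1, xg K 1]

/-- The generic matrix `C2 = (x2, y2; y2', x2')`. -/
def genC₂ (K : Type*) [Field K] : Matrix (Fin 2) (Fin 2) (FreeSuperComm K) :=
  !![xg K 2, yg K 2; yg K 3, xg K 3]

/-- `F = K[C1, C2]`, the unital subalgebra generated by the two generic matrices. -/
def Falg (K : Type*) [Field K] : Subalgebra K (Matrix (Fin 2) (Fin 2) (FreeSuperComm K)) :=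
  Algebra.adjoin K {genC₁ K, genC₂ K}

structure Sys (Z A : Type*) [CommRing Z] [Ring A] [Algebra Z A] where
  (y1 y2 z1 z2 : A)
  (Y W e11 e12 e21 e22 H1 H2 : Z)
  inj : Function.Injective (algebraMap Z A)
  y11 : y1 * y1 = 0
  y22 : y2 * y2 = 0
  z11 : z1 * z1 = 0
  z22 : z2 * z2 = 0
  y12 : y1 * y2 = algebraMap Z A Y
  y21 : y2 * y1 = -algebraMap Z A Y
  z12 : z1 * z2 = algebraMap Z A W
  z21 : z2 * z1 = -algebraMap Z A W
  he11 : y1 * z1 = algebraMap Z A e11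
  he12 : y1 * z2 = algebraMap Z A e12
  he21 : y2 * z1 = algebraMap Z A e21
  he22 : y2 * z2 = algebraMap Z A e22
  hf11 : z1 * y1 = -algebraMap Z A e11
  hf12 : z2 * y1 = -algebraMap Z A e12
  hf21 : z1 * y2 = -algebraMap Z A e21
  hf22 : z2 * y2 = -algebraMap Z A e22

namespace Sys

variable {Z A : Type*} [CommRing Z] [Ring A] [Algebra Z A] (S : Sys Z A)

def Mt (a d b1 b2 c1 c2 : Z) : Matrix (Fin 2) (Fin 2) A :=
  !![algebraMap Z A a, b1 • S.y1 + b2 • S.y2; c1 • S.z1 + c2 • S.z2, algebraMap Z A d]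

lemma Mt_one (a d : Z) : S.Mt a d 1 0 1 0 =
    !![algebraMap Z A a, S.y1; S.z1, algebraMap Z A d] := by
  simp [Mt]

lemma Mt_two (a d : Z) : S.Mt a d 0 1 0 1 =
    !![algebraMap Z A a, S.y2; S.z2, algebraMap Z A d] := by
  simp [Mt]

lemma Mt_zero (a d : Z) : S.Mt a d 0 0 0 0 =
    !![algebraMap Z A a, 0; 0, algebraMap Z A d] := by
  simp [Mt]

lemma Mt_add (a d b1 b2 c1 c2 a' d' b1' b2' c1' c2' : Z) :
    S.Mt a d b1 b2 c1 c2 + S.Mt a' d' b1' b2' c1' c2' =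
      S.Mt (a + a') (d + d') (b1 + b1') (b2 + b2') (c1 + c1') (c2 + c2') := by
  ext i j
  fin_cases i <;> fin_cases j <;> simp [Mt] <;> module

lemma Mt_sub (a d b1 b2 c1 c2 a' d' b1' b2' c1' c2' : Z) :
    S.Mt a d b1 b2 c1 c2 - S.Mt a' d' b1' b2' c1' c2' =
      S.Mt (a - a') (d - d') (b1 - b1') (b2 - b2') (c1 - c1') (c2 - c2') := by
  ext i j
  fin_cases i <;> fin_cases j <;> simp [Mt] <;> module

lemma Mt_mul (a d b1 b2 c1 c2 a' d' b1' b2' c1' c2' : Z) :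
    S.Mt a d b1 b2 c1 c2 * S.Mt a' d' b1' b2' c1' c2' =
      S.Mt (a * a' + (b1 * c1' * S.e11 + b1 * c2' * S.e12 + b2 * c1' * S.e21 + b2 * c2' * S.e22))
        (d * d' - (c1 * b1' * S.e11 + c2 * b1' * S.e12 + c1 * b2' * S.e21 + c2 * b2' * S.e22))
        (a * b1' + b1 * d') (a * b2' + b2 * d') (c1 * a' + d * c1') (c2 * a' + d * c2') := by
  have r : ∀ (x : A) (t : Z), x * algebraMap Z A t = t • x := fun x t => by
    rw [← Algebra.commutes, Algebra.smul_def]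
  have l : ∀ (x : A) (t : Z), algebraMap Z A t * x = t • x := fun x t => by
    rw [Algebra.smul_def]
  ext i j
  fin_cases i <;> fin_cases j
  · simp [Mt, Matrix.mul_apply, Fin.sum_univ_two, mul_add, add_mul, S.he11, S.he12, S.he21, S.he22,
      Algebra.algebraMap_eq_smul_one]
    module
  · simp only [Mt, Matrix.mul_apply, Fin.sum_univ_two]
    simp [r, l]
    module
  · simp only [Mt, Matrix.mul_apply, Fin.sum_univ_two]
    simp [r, l]
    module
  · simp [Mt, Matrix.mul_apply, Fin.sum_univ_two, mul_add, add_mul, S.hf11, S.hf12, S.hf21, S.hf22,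
      Algebra.algebraMap_eq_smul_one]
    module

lemma ey (e t : Z) (y y' z : A) (h : y * z = algebraMap Z A e)
    (h' : y' * y = algebraMap Z A t) : e • y' = t • z := by
  rw [Algebra.smul_def, Algebra.commutes, ← h, ← mul_assoc, h', Algebra.smul_def]

lemma ez (e t : Z) (y z' z : A) (h : y * z = algebraMap Z A e)
    (h' : z * z' = algebraMap Z A t) : e • z' = t • y := by
  rw [Algebra.smul_def, ← h, mul_assoc, h', ← Algebra.commutes, Algebra.smul_def]

lemma e11y1 : S.e11 • S.y1 = 0 := by
  simpa using ey S.e11 0 S.y1 S.y1 S.z1 S.he11 (by simp [S.y11])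
lemma e12y1 : S.e12 • S.y1 = 0 := by
  simpa using ey S.e12 0 S.y1 S.y1 S.z2 S.he12 (by simp [S.y11])
lemma e21y2 : S.e21 • S.y2 = 0 := by
  simpa using ey S.e21 0 S.y2 S.y2 S.z1 S.he21 (by simp [S.y22])
lemma e22y2 : S.e22 • S.y2 = 0 := by
  simpa using ey S.e22 0 S.y2 S.y2 S.z2 S.he22 (by simp [S.y22])
lemma e21y1 : S.e21 • S.y1 = S.Y • S.z1 := ey _ _ _ _ _ S.he21 S.y12
lemma e22y1 : S.e22 • S.y1 = S.Y • S.z2 := ey _ _ _ _ _ S.he22 S.y12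
lemma e11y2 : S.e11 • S.y2 = (-S.Y) • S.z1 := ey _ _ _ _ _ S.he11 (by simp [S.y21])
lemma e12y2 : S.e12 • S.y2 = (-S.Y) • S.z2 := ey _ _ _ _ _ S.he12 (by simp [S.y21])

lemma e11z1 : S.e11 • S.z1 = 0 := by
  simpa using ez S.e11 0 S.y1 S.z1 S.z1 S.he11 (by simp [S.z11])
lemma e21z1 : S.e21 • S.z1 = 0 := by
  simpa using ez S.e21 0 S.y2 S.z1 S.z1 S.he21 (by simp [S.z11])
lemma e12z2 : S.e12 • S.z2 = 0 := by
  simpa using ez S.e12 0 S.y1 S.z2 S.z2 S.he12 (by simp [S.z22])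
lemma e22z2 : S.e22 • S.z2 = 0 := by
  simpa using ez S.e22 0 S.y2 S.z2 S.z2 S.he22 (by simp [S.z22])
lemma e11z2 : S.e11 • S.z2 = S.W • S.y1 := ez _ _ _ _ _ S.he11 S.z12
lemma e21z2 : S.e21 • S.z2 = S.W • S.y2 := ez _ _ _ _ _ S.he21 S.z12
lemma e12z1 : S.e12 • S.z1 = (-S.W) • S.y1 := ez _ _ _ _ _ S.he12 (by simp [S.z21])
lemma e22z1 : S.e22 • S.z1 = (-S.W) • S.y2 := ez _ _ _ _ _ S.he22 (by simp [S.z21])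

lemma Yy1 : S.Y • S.y1 = 0 := by
  rw [Algebra.smul_def, Algebra.commutes, ← S.y12, ← mul_assoc, S.y11, zero_mul]
lemma Yy2 : S.Y • S.y2 = 0 := by
  rw [Algebra.smul_def, ← S.y12, mul_assoc, S.y22, mul_zero]
lemma Wz1 : S.W • S.z1 = 0 := by
  rw [Algebra.smul_def, Algebra.commutes, ← S.z12, ← mul_assoc, S.z11, zero_mul]
lemma Wz2 : S.W • S.z2 = 0 := by
  rw [Algebra.smul_def, ← S.z12, mul_assoc, S.z22, mul_zero]

lemma prodE (S : Sys Z A) (x e t : Z) (y z u : A) (h : y * z = algebraMap Z A e) (h1 : x • y = t • u)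
    (w : Z) (h2 : u * z = algebraMap Z A w) : x * e = t * w := by
  apply S.inj
  rw [map_mul, map_mul, ← h, ← mul_assoc, ← Algebra.smul_def, h1, smul_mul_assoc, h2,
    Algebra.smul_def]

lemma prod0 (S : Sys Z A) (x e : Z) (y z : A) (h : y * z = algebraMap Z A e) (h1 : x • y = 0) : x * e = 0 := by
  apply S.inj
  rw [map_mul, ← h, ← mul_assoc, ← Algebra.smul_def, h1, zero_mul, map_zero]

lemma prod0' (S : Sys Z A) (x e : Z) (y z : A) (h : y * z = algebraMap Z A e) (h1 : x • z = 0) : x * e = 0 := by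
  apply S.inj
  rw [map_mul, ← h, ← mul_assoc, Algebra.commutes, mul_assoc, ← Algebra.smul_def, h1, mul_zero,
    map_zero]

lemma Ye11 : S.Y * S.e11 = 0 := S.prod0 _ _ _ _ S.he11 S.Yy1
lemma Ye12 : S.Y * S.e12 = 0 := S.prod0 _ _ _ _ S.he12 S.Yy1
lemma Ye21 : S.Y * S.e21 = 0 := S.prod0 _ _ _ _ S.he21 S.Yy2
lemma Ye22 : S.Y * S.e22 = 0 := S.prod0 _ _ _ _ S.he22 S.Yy2
lemma We11 : S.W * S.e11 = 0 := S.prod0' _ _ _ _ S.he11 S.Wz1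
lemma We12 : S.W * S.e12 = 0 := S.prod0' _ _ _ _ S.he12 S.Wz2
lemma We21 : S.W * S.e21 = 0 := S.prod0' _ _ _ _ S.he21 S.Wz1
lemma We22 : S.W * S.e22 = 0 := S.prod0' _ _ _ _ S.he22 S.Wz2
lemma p1111 : S.e11 * S.e11 = 0 := S.prod0 _ _ _ _ S.he11 S.e11y1
lemma p1112 : S.e11 * S.e12 = 0 := S.prod0 _ _ _ _ S.he12 S.e11y1
lemma p1212 : S.e12 * S.e12 = 0 := S.prod0 _ _ _ _ S.he12 S.e12y1
lemma p2121 : S.e21 * S.e21 = 0 := S.prod0 _ _ _ _ S.he21 S.e21y2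
lemma p2122 : S.e21 * S.e22 = 0 := S.prod0 _ _ _ _ S.he22 S.e21y2
lemma p2222 : S.e22 * S.e22 = 0 := S.prod0 _ _ _ _ S.he22 S.e22y2
lemma p1121 : S.e11 * S.e21 = 0 := S.prod0' _ _ _ _ S.he21 S.e11z1
lemma p1222 : S.e12 * S.e22 = 0 := S.prod0' _ _ _ _ S.he22 S.e12z2
lemma p1122 : S.e11 * S.e22 = -S.Y * S.W := S.prodE _ _ _ _ _ _ S.he22 S.e11y2 _ S.z12
lemma p1221 : S.e12 * S.e21 = -S.Y * -S.W :=
  S.prodE _ _ _ _ _ _ S.he21 S.e12y2 _ (by simp [S.z21])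

def InT (M : Matrix (Fin 2) (Fin 2) A) : Prop :=
  ∃ a d b1 b2 c1 c2 : Z, M = S.Mt a d b1 b2 c1 c2 ∧
    S.Y * (b1 * S.H1 + b2 * S.H2 - (a - d)) = 0 ∧
    S.W * (c1 * S.H1 + c2 * S.H2 - (a - d)) = 0

lemma InT.add {M N : Matrix (Fin 2) (Fin 2) A} (hM : S.InT M) (hN : S.InT N) :
    S.InT (M + N) := by
  obtain ⟨a, d, b1, b2, c1, c2, rfl, h1, h2⟩ := hM
  obtain ⟨a', d', b1', b2', c1', c2', rfl, h1', h2'⟩ := hN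
  refine ⟨_, _, _, _, _, _, S.Mt_add _ _ _ _ _ _ _ _ _ _ _ _, ?_, ?_⟩
  · linear_combination h1 + h1'
  · linear_combination h2 + h2'

lemma InT.mul {M N : Matrix (Fin 2) (Fin 2) A} (hM : S.InT M) (hN : S.InT N) :
    S.InT (M * N) := by
  obtain ⟨a, d, b1, b2, c1, c2, rfl, h1, h2⟩ := hM
  obtain ⟨a', d', b1', b2', c1', c2', rfl, h1', h2'⟩ := hN
  refine ⟨_, _, _, _, _, _, S.Mt_mul _ _ _ _ _ _ _ _ _ _ _ _, ?_, ?_⟩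
  · linear_combination a * h1' + d' * h1 - (b1 * c1' + c1 * b1') * S.Ye11
      - (b1 * c2' + c2 * b1') * S.Ye12 - (b2 * c1' + c1 * b2') * S.Ye21
      - (b2 * c2' + c2 * b2') * S.Ye22
  · linear_combination a' * h2 + d * h2' - (b1 * c1' + c1 * b1') * S.We11
      - (b1 * c2' + c2 * b1') * S.We12 - (b2 * c1' + c1 * b2') * S.We21
      - (b2 * c2' + c2 * b2') * S.We22

/-- Shape of commutators of elements satisfying `InT`. -/
def Com (M : Matrix (Fin 2) (Fin 2) A) (p B1 B2 C1 C2 s t p11 p12 p21 p22 : Z) : Prop :=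
  M = S.Mt p p B1 B2 C1 C2 ∧
  p = p11 * S.e11 + p12 * S.e12 + p21 * S.e21 + p22 * S.e22 ∧
  S.Y * (B1 + s * S.H2) = 0 ∧ S.Y * (B2 - s * S.H1) = 0 ∧
  S.W * (C1 - t * S.H2) = 0 ∧ S.W * (C2 + t * S.H1) = 0 ∧
  S.Y * (p11 * S.H1 + p21 * S.H2 + C1) = 0 ∧ S.Y * (p12 * S.H1 + p22 * S.H2 + C2) = 0 ∧
  S.W * (p11 * S.H1 + p12 * S.H2 + B1) = 0 ∧ S.W * (p21 * S.H1 + p22 * S.H2 + B2) = 0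

lemma com {M N : Matrix (Fin 2) (Fin 2) A} (hM : S.InT M) (hN : S.InT N) :
    ∃ p B1 B2 C1 C2 s t p11 p12 p21 p22 : Z,
      S.Com (M * N - N * M) p B1 B2 C1 C2 s t p11 p12 p21 p22 := by
  obtain ⟨a, d, b1, b2, c1, c2, rfl, h1, h2⟩ := hM
  obtain ⟨a', d', b1', b2', c1', c2', rfl, h1', h2'⟩ := hN
  refine ⟨_, (a - d) * b1' - (a' - d') * b1, (a - d) * b2' - (a' - d') * b2,
    (a' - d') * c1 - (a - d) * c1', (a' - d') * c2 - (a - d) * c2',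
    b1 * b2' - b2 * b1', c1 * c2' - c2 * c1',
    b1 * c1' - b1' * c1, b1 * c2' - b1' * c2, b2 * c1' - b2' * c1, b2 * c2' - b2' * c2,
    ?_, rfl, ?_, ?_, ?_, ?_, ?_, ?_, ?_, ?_⟩
  · rw [Mt_mul, Mt_mul, Mt_sub]
    congr 1 <;> ring
  · linear_combination (-b1') * h1 + b1 * h1'
  · linear_combination (-b2') * h1 + b2 * h1'
  · linear_combination c1' * h2 - c1 * h2'
  · linear_combination c2' * h2 - c2 * h2'
  · linear_combination c1' * h1 - c1 * h1'
  · linear_combination c2' * h1 - c2 * h1'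
  · linear_combination (-b1') * h2 + b1 * h2'
  · linear_combination (-b2') * h2 + b2 * h2'

lemma final {M N P : Matrix (Fin 2) (Fin 2) A}
    {p B1 B2 C1 C2 s t p11 p12 p21 p22 q D1 D2 E1 E2 s' t' q11 q12 q21 q22 : Z}
    (hM : S.Com M p B1 B2 C1 C2 s t p11 p12 p21 p22)
    (hN : S.Com N q D1 D2 E1 E2 s' t' q11 q12 q21 q22)
    (hP : S.InT P) : (M * N) * P - P * (M * N) = 0 := by
  obtain ⟨rfl, hp, m1, m2, m3, m4, m5, m6, m7, m8⟩ := hM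
  obtain ⟨rfl, hq, n1, n2, n3, n4, n5, n6, n7, n8⟩ := hN
  obtain ⟨a, d, b1, b2, c1, c2, rfl, h1, h2⟩ := hP
  -- coefficients
  have k1 : S.Y * ((B2 * b1 - B1 * b2) * E1 + (D2 * b1 - D1 * b2) * C1
      - (a - d) * (p21 * D1 - p11 * D2 + q21 * B1 - q11 * B2)) = 0 := by
    linear_combination E1 * (b1 * m2 - b2 * m1 + s * h1) + C1 * (b1 * n2 - b2 * n1 + s' * h1)
      - (a - d) * (p21 * n1 - p11 * n2 - s' * m5 + q21 * m1 - q11 * m2 - s * n5)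
  have k2 : S.Y * ((B2 * b1 - B1 * b2) * E2 + (D2 * b1 - D1 * b2) * C2
      - (a - d) * (p22 * D1 - p12 * D2 + q22 * B1 - q12 * B2)) = 0 := by
    linear_combination E2 * (b1 * m2 - b2 * m1 + s * h1) + C2 * (b1 * n2 - b2 * n1 + s' * h1)
      - (a - d) * (p22 * n1 - p12 * n2 - s' * m6 + q22 * m1 - q12 * m2 - s * n6)
  have l1 : S.W * ((C2 * c1 - C1 * c2) * D1 + (E2 * c1 - E1 * c2) * B1
      + (a - d) * (p11 * E2 - p12 * E1 + q11 * C2 - q12 * C1)) = 0 := by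
    linear_combination D1 * (c1 * m4 - c2 * m3 - t * h2) + B1 * (c1 * n4 - c2 * n3 - t' * h2)
      + (a - d) * (p11 * n4 - p12 * n3 - t' * m7 + q11 * m4 - q12 * m3 - t * n7)
  have l2 : S.W * ((C2 * c1 - C1 * c2) * D2 + (E2 * c1 - E1 * c2) * B2
      + (a - d) * (p21 * E2 - p22 * E1 + q21 * C2 - q22 * C1)) = 0 := by
    linear_combination D2 * (c1 * m4 - c2 * m3 - t * h2) + B2 * (c1 * n4 - c2 * n3 - t' * h2)
      + (a - d) * (p21 * n4 - p22 * n3 - t' * m8 + q21 * m4 - q22 * m3 - t * n8)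
  have g : S.Y * S.W * (-p11 * (D2 * c2 - b2 * E2) - p22 * (D1 * c1 - b1 * E1) + p12 * (D2 * c1 - b2 * E1) + p21 * (D1 * c2 - b1 * E2)
      + (-q11 * (B2 * c2 - b2 * C2) - q22 * (B1 * c1 - b1 * C1) + q12 * (B2 * c1 - b2 * C1) + q21 * (B1 * c2 - b1 * C2))) = 0 := by
    linear_combination S.W * (c1 * (p12 * n2 - p22 * n1) + c2 * (p21 * n1 - p11 * n2) + s' * c1 * m6 - s' * c2 * m5)
      + S.Y * (s' * c2 * m3 - s' * c1 * m4 + s' * t * h2)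
      + S.Y * (b2 * (p11 * n4 - p12 * n3) + b1 * (p22 * n3 - p21 * n4) - t' * b2 * m7 + t' * b1 * m8)
      + S.W * (t' * b2 * m1 - t' * b1 * m2 - t' * s * h1)
      + S.W * (c1 * (q12 * m2 - q22 * m1) + c2 * (q21 * m1 - q11 * m2) + s * c1 * n6 - s * c2 * n5)
      + S.Y * (s * c2 * n3 - s * c1 * n4 + s * t' * h2)
      + S.Y * (b2 * (q11 * m4 - q12 * m3) + b1 * (q22 * m3 - q21 * m4) - t * b2 * n7 + t * b1 * n8)
      + S.W * (t * b2 * n1 - t * b1 * n2 - t * s' * h1)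
  have ex : ∀ u11 u12 u21 u22 v11 v12 v21 v22 : Z,
      (u11 * S.e11 + u12 * S.e12 + u21 * S.e21 + u22 * S.e22) *
      (v11 * S.e11 + v12 * S.e12 + v21 * S.e21 + v22 * S.e22) =
      S.Y * S.W * (u12 * v21 + u21 * v12 - u11 * v22 - u22 * v11) := by
    intro u11 u12 u21 u22 v11 v12 v21 v22
    linear_combination u11 * v11 * S.p1111 + (u11 * v12 + u12 * v11) * S.p1112
      + u12 * v12 * S.p1212 + u21 * v21 * S.p2121 + (u21 * v22 + u22 * v21) * S.p2122
      + u22 * v22 * S.p2222 + (u11 * v21 + u21 * v11) * S.p1121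
      + (u12 * v22 + u22 * v12) * S.p1222 + (u11 * v22 + u22 * v11) * S.p1122
      + (u12 * v21 + u21 * v12) * S.p1221
  have g1 := ex p11 p12 p21 p22 (D1 * c1 - b1 * E1) (D1 * c2 - b1 * E2) (D2 * c1 - b2 * E1)
    (D2 * c2 - b2 * E2)
  have g2 := ex q11 q12 q21 q22 (B1 * c1 - b1 * C1) (B1 * c2 - b1 * C2) (B2 * c1 - b2 * C1)
    (B2 * c2 - b2 * C2)
  rw [← hp] at g1
  rw [← hq] at g2
  have hU : ∀ X1 X2 : Z, X1 = 0 → X2 = 0 → ∀ x y : A, X1 • x + X2 • y = 0 := by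
    rintro _ _ rfl rfl x y
    simp
  rw [Mt_mul, Mt_mul, Mt_mul, Mt_sub]
  ext i j
  fin_cases i <;> fin_cases j
  · simp only [Mt]
    show algebraMap Z A _ = 0
    rw [← map_zero (algebraMap Z A)]
    congr 1
    linear_combination g1 + g2 + g
  · show _ • S.y1 + _ • S.y2 = 0
    rw [hp, hq]
    linear_combination (norm := module) (b1 * (B1 * E1 + D1 * C1) - (a - d) * (p11 * D1 + q11 * B1)) • S.e11y1
      + (b1 * (B1 * E2 + D1 * C2) - (a - d) * (p12 * D1 + q12 * B1)) • S.e12y1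
      + (b1 * (B2 * E1 + D2 * C1) - (a - d) * (p21 * D1 + q21 * B1)) • S.e21y1
      + (b1 * (B2 * E2 + D2 * C2) - (a - d) * (p22 * D1 + q22 * B1)) • S.e22y1
      + (b2 * (B1 * E1 + D1 * C1) - (a - d) * (p11 * D2 + q11 * B2)) • S.e11y2
      + (b2 * (B1 * E2 + D1 * C2) - (a - d) * (p12 * D2 + q12 * B2)) • S.e12y2
      + (b2 * (B2 * E1 + D2 * C1) - (a - d) * (p21 * D2 + q21 * B2)) • S.e21y2
      + (b2 * (B2 * E2 + D2 * C2) - (a - d) * (p22 * D2 + q22 * B2)) • S.e22y2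
      + k1 • S.z1
      + k2 • S.z2
  · show _ • S.z1 + _ • S.z2 = 0
    rw [hp, hq]
    linear_combination (norm := module) ((a - d) * (p11 * E1 + q11 * C1) - c1 * (B1 * E1 + D1 * C1)) • S.e11z1
      + ((a - d) * (p12 * E1 + q12 * C1) - c1 * (B1 * E2 + D1 * C2)) • S.e12z1
      + ((a - d) * (p21 * E1 + q21 * C1) - c1 * (B2 * E1 + D2 * C1)) • S.e21z1
      + ((a - d) * (p22 * E1 + q22 * C1) - c1 * (B2 * E2 + D2 * C2)) • S.e22z1
      + ((a - d) * (p11 * E2 + q11 * C2) - c2 * (B1 * E1 + D1 * C1)) • S.e11z2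
      + ((a - d) * (p12 * E2 + q12 * C2) - c2 * (B1 * E2 + D1 * C2)) • S.e12z2
      + ((a - d) * (p21 * E2 + q21 * C2) - c2 * (B2 * E1 + D2 * C1)) • S.e21z2
      + ((a - d) * (p22 * E2 + q22 * C2) - c2 * (B2 * E2 + D2 * C2)) • S.e22z2
      + l1 • S.y1
      + l2 • S.y2
  · simp only [Mt]
    show algebraMap Z A _ = 0
    rw [← map_zero (algebraMap Z A)]
    congr 1
    linear_combination g1 + g2 + g

end Sys

lemma xg_central (K : Type*) [Field K] (i : Fin 4) : xg K i ∈ Subring.center (FreeSuperComm K) := by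
  rw [Subring.mem_center_iff]
  intro g
  induction g using TensorProduct.induction_on with
  | zero => simp
  | tmul p m => simp [xg, mul_comm]
  | add u v hu hv => rw [add_mul, mul_add, hu, hv]

lemma yg_sq (K : Type*) [Field K] (i : Fin 4) : yg K i * yg K i = 0 := by
  simp [yg]

lemma yg_anti (K : Type*) [Field K] (i j : Fin 4) : yg K j * yg K i = - (yg K i * yg K j) := by
  rw [eq_neg_iff_add_eq_zero]
  simp only [yg, Algebra.TensorProduct.tmul_mul_tmul, ← TensorProduct.tmul_add,
    ExteriorAlgebra.ι_add_mul_swap, TensorProduct.tmul_zero]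

lemma ext_central (K : Type*) [Field K] (u v : Fin 4 → K) (m : ExteriorAlgebra K (Fin 4 → K)) :
    m * (ExteriorAlgebra.ι K u * ExteriorAlgebra.ι K v) =
      (ExteriorAlgebra.ι K u * ExteriorAlgebra.ι K v) * m := by
  induction m using ExteriorAlgebra.induction with
  | algebraMap r => exact Algebra.commutes _ _
  | ι w =>
    have h1 := eq_neg_of_add_eq_zero_left (ExteriorAlgebra.ι_add_mul_swap (R := K) w u)
    have h2 := eq_neg_of_add_eq_zero_left (ExteriorAlgebra.ι_add_mul_swap (R := K) w v)
    rw [← mul_assoc, h1, neg_mul, mul_assoc, h2, mul_neg, neg_neg, mul_assoc]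
  | mul a b ha hb => rw [mul_assoc, hb, ← mul_assoc, ha, mul_assoc]
  | add a b ha hb => rw [add_mul, mul_add, ha, hb]

lemma yy_central (K : Type*) [Field K] (i j : Fin 4) :
    yg K i * yg K j ∈ Subring.center (FreeSuperComm K) := by
  rw [Subring.mem_center_iff]
  intro g
  induction g using TensorProduct.induction_on with
  | zero => simp
  | tmul p m =>
    simp only [yg, Algebra.TensorProduct.tmul_mul_tmul, ext_central, mul_one, one_mul]
  | add u v hu hv => rw [add_mul, mul_add, hu, hv]

def theSys (K : Type*) [Field K] : Sys (Subring.center (FreeSuperComm K)) (FreeSuperComm K) where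
  y1 := yg K 0
  y2 := yg K 2
  z1 := yg K 1
  z2 := yg K 3
  Y := ⟨_, yy_central K 0 2⟩
  W := ⟨_, yy_central K 1 3⟩
  e11 := ⟨_, yy_central K 0 1⟩
  e12 := ⟨_, yy_central K 0 3⟩
  e21 := ⟨_, yy_central K 2 1⟩
  e22 := ⟨_, yy_central K 2 3⟩
  H1 := ⟨_, xg_central K 0⟩ - ⟨_, xg_central K 1⟩
  H2 := ⟨_, xg_central K 2⟩ - ⟨_, xg_central K 3⟩
  inj := Subtype.val_injective
  y11 := yg_sq K _
  y22 := yg_sq K _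
  z11 := yg_sq K _
  z22 := yg_sq K _
  y12 := rfl
  y21 := yg_anti K _ _
  z12 := rfl
  z21 := yg_anti K _ _
  he11 := rfl
  he12 := rfl
  he21 := rfl
  he22 := rfl
  hf11 := yg_anti K _ _
  hf12 := yg_anti K _ _
  hf21 := yg_anti K _ _
  hf22 := yg_anti K _ _

lemma inT_of_mem (K : Type*) [Field K] (a : Matrix (Fin 2) (Fin 2) (FreeSuperComm K))
    (h : a ∈ Falg K) : (theSys K).InT a := by
  unfold Falg at h
  induction h using Algebra.adjoin_induction with
  | mem x hx =>
    rcases hx with rfl | rfl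
    · refine ⟨⟨_, xg_central K 0⟩, ⟨_, xg_central K 1⟩, 1, 0, 1, 0, ?_, ?_, ?_⟩
      · rw [Sys.Mt_one]
        rfl
      · simp [theSys]
      · simp [theSys]
    · refine ⟨⟨_, xg_central K 2⟩, ⟨_, xg_central K 3⟩, 0, 1, 0, 1, ?_, ?_, ?_⟩
      · rw [Sys.Mt_two]
        rfl
      · simp [theSys]
      · simp [theSys]
  | algebraMap r =>
    have hr : algebraMap K (FreeSuperComm K) r ∈ Subring.center (FreeSuperComm K) :=
      Subring.mem_center_iff.2 fun g => (Algebra.commutes r g).symm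
    refine ⟨⟨_, hr⟩, ⟨_, hr⟩, 0, 0, 0, 0, ?_, by simp, by simp⟩
    rw [Sys.Mt_zero]
    ext i j
    fin_cases i <;> fin_cases j <;> simp [Matrix.algebraMap_matrix_apply] <;> rfl
  | add x y _ _ hx hy => exact Sys.InT.add _ hx hy
  | mul x y _ _ hx hy => exact Sys.InT.mul _ hx hy

theorem stmt0 (K : Type*) [Field K] [CharZero K]
    (a₁ a₂ a₃ a₄ a₅ : Matrix (Fin 2) (Fin 2) (FreeSuperComm K))
    (h₁ : a₁ ∈ Falg K) (h₂ : a₂ ∈ Falg K) (h₃ : a₃ ∈ Falg K)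
    (h₄ : a₄ ∈ Falg K) (h₅ : a₅ ∈ Falg K) :
    ((a₁ * a₂ - a₂ * a₁) * (a₃ * a₄ - a₄ * a₃)) * a₅
      - a₅ * ((a₁ * a₂ - a₂ * a₁) * (a₃ * a₄ - a₄ * a₃)) = 0 := by
  obtain ⟨_, _, _, _, _, _, _, _, _, _, _, hM⟩ :=
    (theSys K).com (inT_of_mem K a₁ h₁) (inT_of_mem K a₂ h₂)
  obtain ⟨_, _, _, _, _, _, _, _, _, _, _, hN⟩ :=
    (theSys K).com (inT_of_mem K a₃ h₃) (inT_of_mem K a₄ h₄)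
  exact (theSys K).final hM hN (inT_of_mem K a₅ h₅)
end
end

section
/- For all a1, a2, a3, a4, a5, a6 in F, [a1,a2][a3,a4][a5,a6] = 0; that is, the product of any three commutators of elements of F vanishes, so [t1,t2][t3,t4][t5,t6] is a polynomial identity of F. -/
open scoped TensorProduct

noncomputable section

section helpers

variable {K : Type*} [Field K]

lemma ext_twist (w : ExteriorAlgebra K (Fin 4 → K)) :
    ∃ w' : ExteriorAlgebra K (Fin 4 → K), ∀ v, ExteriorAlgebra.ι K v * w
      = w' * ExteriorAlgebra.ι K v := by
  induction w using ExteriorAlgebra.induction with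
  | algebraMap r => exact ⟨algebraMap _ _ r, fun v => (Algebra.commutes r _).symm⟩
  | ι u =>
    refine ⟨- ExteriorAlgebra.ι K u, fun v => ?_⟩
    have := ExteriorAlgebra.ι_add_mul_swap (R := K) v u
    rw [neg_mul]
    exact eq_neg_of_add_eq_zero_left this
  | mul a b ha hb =>
    obtain ⟨a', ha⟩ := ha
    obtain ⟨b', hb⟩ := hb
    exact ⟨a' * b', fun v => by rw [← mul_assoc, ha, mul_assoc, hb, mul_assoc]⟩
  | add a b ha hb =>
    obtain ⟨a', ha⟩ := ha
    obtain ⟨b', hb⟩ := hb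
    exact ⟨a' + b', fun v => by rw [mul_add, ha, hb, add_mul]⟩

lemma y_twist (r : FreeSuperComm K) :
    ∃ r' : FreeSuperComm K, ∀ i, yg K i * r = r' * yg K i := by
  induction r using TensorProduct.induction_on with
  | zero => exact ⟨0, by simp⟩
  | tmul f w =>
    obtain ⟨w', hw⟩ := ext_twist w
    refine ⟨f ⊗ₜ w', fun i => ?_⟩
    simp [yg, hw]
  | add a b ha hb =>
    obtain ⟨a', ha⟩ := ha
    obtain ⟨b', hb⟩ := hb
    exact ⟨a' + b', fun v => by rw [mul_add, ha, hb, add_mul]⟩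

lemma x_comm (i : Fin 4) (r : FreeSuperComm K) : r * xg K i = xg K i * r := by
  induction r using TensorProduct.induction_on with
  | zero => simp
  | tmul f w => simp [xg, mul_comm]
  | add a b ha hb => rw [mul_add, add_mul, ha, hb]

lemma y_sq (i : Fin 4) : yg K i * yg K i = 0 := by simp [yg]

lemma y_anti (i j : Fin 4) : yg K i * yg K j = - (yg K j * yg K i) := by
  have := ExteriorAlgebra.ι_add_mul_swap (R := K) (Pi.single i (1 : K)) (Pi.single j 1 : Fin 4 → K)
  simp only [yg, Algebra.TensorProduct.tmul_mul_tmul, mul_one]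
  rw [eq_neg_of_add_eq_zero_left this, TensorProduct.tmul_neg]

variable (K) in
/-- The entries of the commutator of the generic matrices. -/
def dd : Fin 3 → FreeSuperComm K :=
  ![yg K 0 * yg K 3 - yg K 2 * yg K 1,
    (xg K 0 - xg K 1) * yg K 2 - (xg K 2 - xg K 3) * yg K 0,
    (xg K 0 - xg K 1) * yg K 3 - (xg K 2 - xg K 3) * yg K 1]

lemma abstract3 {R : Type*} [Ring R] (s t a b c e : R)
    (hs : ∀ r, r * s = s * r) (ht : ∀ r, r * t = t * r)
    (haa : a * a = 0) (hbb : b * b = 0) (hcc : c * c = 0) (hee : e * e = 0)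
    (hba : b * a = -(a * b)) (hca : c * a = -(a * c)) (hea : e * a = -(a * e))
    (hcb : c * b = -(b * c)) (heb : e * b = -(b * e)) (hec : e * c = -(c * e))
    (d : Fin 3 → R) (hd : d = ![a * e - c * b, s * c - t * a, s * e - t * b]) (i j k : Fin 3) :
    d i * (d j * d k) = 0 := by
  have hl : ∀ {x y : R}, x * y = -(y * x) → ∀ z, x * (y * z) = -(y * (x * z)) := by
    intro x y h z
    rw [← mul_assoc, h, neg_mul, mul_assoc]
  have h0 : ∀ {x : R}, x * x = 0 → ∀ z, x * (x * z) = 0 := by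
    intro x h z
    rw [← mul_assoc, h, zero_mul]
  have hc : ∀ {x : R}, (∀ r, r * x = x * r) → ∀ y z, y * (x * z) = x * (y * z) := by
    intro x h y z
    rw [← mul_assoc, h, mul_assoc]
  have s1 := hc hs
  have t1 := hc ht
  have as := s1 a
  have bs := s1 b
  have cs := s1 c
  have es := s1 e
  have at' := t1 a
  have bt := t1 b
  have ct := t1 c
  have et := t1 e
  have ts := s1 t
  have l1 := hl hba
  have l2 := hl hca
  have l3 := hl hea
  have l4 := hl hcb
  have l5 := hl heb
  have l6 := hl hec
  have z1 := h0 haa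
  have z2 := h0 hbb
  have z3 := h0 hcc
  have z4 := h0 hee
  clear hc hl h0 s1 t1 hs ht
  subst hd
  fin_cases i <;> fin_cases j <;> fin_cases k <;>
    simp [mul_sub, sub_mul, mul_add, add_mul, mul_assoc, *]

lemma dd3 (i j k : Fin 3) : dd K i * (dd K j * dd K k) = 0 := by
  refine abstract3 (xg K 0 - xg K 1) (xg K 2 - xg K 3) (yg K 0) (yg K 1) (yg K 2) (yg K 3)
    ?_ ?_ (y_sq _) (y_sq _) (y_sq _) (y_sq _) (y_anti _ _) (y_anti _ _) (y_anti _ _)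
    (y_anti _ _) (y_anti _ _) (y_anti _ _) (dd K) rfl i j k
  · intro r
    rw [mul_sub, sub_mul, x_comm, x_comm]
  · intro r
    rw [mul_sub, sub_mul, x_comm, x_comm]

lemma dd_twist (i : Fin 3) (r : FreeSuperComm K) :
    ∃ r' : FreeSuperComm K, dd K i * r = r' * dd K i := by
  obtain ⟨r', h⟩ := y_twist r
  obtain ⟨r'', h'⟩ := y_twist r'
  have hx : ∀ i j k, (xg K i - xg K j) * yg K k * r = r' * ((xg K i - xg K j) * yg K k) := by
    intro i j k
    rw [mul_assoc, h, ← mul_assoc, ← mul_assoc, mul_sub, x_comm, x_comm, sub_mul]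
  fin_cases i
  · refine ⟨r'', ?_⟩
    simp only [dd, Fin.zero_eta, Matrix.cons_val_zero]
    simp only [sub_mul, mul_sub, mul_assoc, h]
    simp only [← mul_assoc, h']
  · refine ⟨r', ?_⟩
    change (_ - _) * r = r' * (_ - _)
    rw [sub_mul, hx, hx, mul_sub]
  · refine ⟨r', ?_⟩
    change (_ - _) * r = r' * (_ - _)
    rw [sub_mul, hx, hx, mul_sub]

variable (K) in
/-- The left ideal spanned by the entries. -/
def SI : Ideal (FreeSuperComm K) := Ideal.span (Set.range (dd K))

lemma SI_right {a : FreeSuperComm K} (ha : a ∈ SI K) (r : FreeSuperComm K) : a * r ∈ SI K := by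
  induction ha using Submodule.span_induction with
  | mem x hx =>
    obtain ⟨i, rfl⟩ := hx
    obtain ⟨r', h⟩ := dd_twist i r
    rw [h]
    exact Ideal.mul_mem_left _ _ (Ideal.subset_span ⟨i, rfl⟩)
  | zero => rw [zero_mul]; exact Ideal.zero_mem _
  | add x y _ _ hx hy => rw [add_mul]; exact Ideal.add_mem _ hx hy
  | smul c x _ hx => rw [smul_eq_mul, mul_assoc]; exact Ideal.mul_mem_left _ _ hx

lemma SI3 {a b c : FreeSuperComm K} (ha : a ∈ SI K) (hb : b ∈ SI K) (hc : c ∈ SI K) :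
    a * (b * c) = 0 := by
  have h1 : ∀ i j, dd K i * (dd K j * c) = 0 := by
    intro i j
    induction hc using Submodule.span_induction with
    | mem x hx => obtain ⟨k, rfl⟩ := hx; exact dd3 i j k
    | zero => simp
    | add x y _ _ hx hy => rw [mul_add, mul_add, hx, hy, add_zero]
    | smul r x _ hx =>
      obtain ⟨r', h⟩ := dd_twist j r
      obtain ⟨r'', h'⟩ := dd_twist i r'
      rw [smul_eq_mul, ← mul_assoc (dd K j), h, mul_assoc, ← mul_assoc, h', mul_assoc, hx,
        mul_zero]
  have h2 : ∀ i, dd K i * (b * c) = 0 := by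
    intro i
    induction hb using Submodule.span_induction with
    | mem x hx => obtain ⟨k, rfl⟩ := hx; exact h1 i k
    | zero => simp
    | add x y _ _ hx hy => rw [add_mul, mul_add, hx, hy, add_zero]
    | smul r x _ hx =>
      obtain ⟨r', h⟩ := dd_twist i r
      rw [smul_eq_mul, mul_assoc, ← mul_assoc (dd K i), h, mul_assoc, hx, mul_zero]
  induction ha using Submodule.span_induction with
  | mem x hx => obtain ⟨k, rfl⟩ := hx; exact h2 k
  | zero => simp
  | add x y _ _ hx hy => rw [add_mul, hx, hy, add_zero]
  | smul r x _ hx => rw [smul_eq_mul, mul_assoc, hx, mul_zero]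

/-- All entries lie in the ideal. -/
def PS (M : Matrix (Fin 2) (Fin 2) (FreeSuperComm K)) : Prop := ∀ i j, M i j ∈ SI K

lemma PS_add {M N : Matrix (Fin 2) (Fin 2) (FreeSuperComm K)} (h : PS M) (h' : PS N) :
    PS (M + N) := fun i j => Ideal.add_mem _ (h i j) (h' i j)

lemma PS_zero : PS (0 : Matrix (Fin 2) (Fin 2) (FreeSuperComm K)) :=
  fun _ _ => Ideal.zero_mem _

lemma PS_neg {M : Matrix (Fin 2) (Fin 2) (FreeSuperComm K)} (h : PS M) : PS (-M) :=
  fun i j => neg_mem (h i j)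

lemma PS_left {M : Matrix (Fin 2) (Fin 2) (FreeSuperComm K)} (h : PS M)
    (N : Matrix (Fin 2) (Fin 2) (FreeSuperComm K)) : PS (N * M) := fun i j => by
  rw [Matrix.mul_apply]
  exact Ideal.sum_mem _ fun k _ => Ideal.mul_mem_left _ _ (h k j)

lemma PS_right {M : Matrix (Fin 2) (Fin 2) (FreeSuperComm K)} (h : PS M)
    (N : Matrix (Fin 2) (Fin 2) (FreeSuperComm K)) : PS (M * N) := fun i j => by
  rw [Matrix.mul_apply]
  exact Ideal.sum_mem _ fun k _ => SI_right (h i k) _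

lemma PS3 {A B C : Matrix (Fin 2) (Fin 2) (FreeSuperComm K)} (hA : PS A) (hB : PS B)
    (hC : PS C) : A * B * C = 0 := by
  rw [mul_assoc]
  ext i j
  simp only [Matrix.mul_apply, Finset.mul_sum, Matrix.zero_apply]
  exact Finset.sum_eq_zero fun k _ => Finset.sum_eq_zero fun l _ => SI3 (hA _ _) (hB _ _) (hC _ _)

lemma PS_gen : PS (genC₁ K * genC₂ K - genC₂ K * genC₁ K) := by
  have m : ∀ i, dd K i ∈ SI K := fun i => Ideal.subset_span ⟨i, rfl⟩
  have m0 : yg K 0 * yg K 3 - yg K 2 * yg K 1 ∈ SI K := m 0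
  have m1 : (xg K 0 - xg K 1) * yg K 2 - (xg K 2 - xg K 3) * yg K 0 ∈ SI K := m 1
  have m2 : (xg K 0 - xg K 1) * yg K 3 - (xg K 2 - xg K 3) * yg K 1 ∈ SI K := m 2
  intro i j
  fin_cases i <;> fin_cases j
  · convert m0 using 1
    simp [genC₁, genC₂, Matrix.mul_apply, Fin.sum_univ_two]
    rw [x_comm 2 (xg K 0)]
    abel
  · convert m1 using 1
    simp [genC₁, genC₂, Matrix.mul_apply, Fin.sum_univ_two]
    rw [x_comm 3 (yg K 0), x_comm 1 (yg K 2)]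
    simp only [sub_mul]
    abel
  · convert neg_mem m2 using 1
    simp [genC₁, genC₂, Matrix.mul_apply, Fin.sum_univ_two]
    rw [x_comm 2 (yg K 1), x_comm 0 (yg K 3)]
    simp only [sub_mul]
    abel
  · convert m0 using 1
    simp [genC₁, genC₂, Matrix.mul_apply, Fin.sum_univ_two]
    rw [x_comm 3 (xg K 1), y_anti 1 2, y_anti 3 0]
    abel

lemma PS_comm_left {b : Matrix (Fin 2) (Fin 2) (FreeSuperComm K)}
    (h1 : PS (genC₁ K * b - b * genC₁ K)) (h2 : PS (genC₂ K * b - b * genC₂ K))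
    {a : Matrix (Fin 2) (Fin 2) (FreeSuperComm K)} (ha : a ∈ Falg K) :
    PS (a * b - b * a) := by
  induction ha using Algebra.adjoin_induction with
  | mem x hx =>
    rcases hx with rfl | rfl
    · exact h1
    · exact h2
  | algebraMap r =>
    rw [Algebra.commutes, sub_self]
    exact PS_zero
  | add x y _ _ hx hy =>
    have : (x + y) * b - b * (x + y) = (x * b - b * x) + (y * b - b * y) := by noncomm_ring
    rw [this]
    exact PS_add hx hy
  | mul x y _ _ hx hy =>
    have : (x * y) * b - b * (x * y) = x * (y * b - b * y) + (x * b - b * x) * y := by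
      simp only [sub_mul, mul_sub, mul_assoc]
      abel
    rw [this]
    exact PS_add (PS_left hy _) (PS_right hx _)

lemma PS_swap {a b : Matrix (Fin 2) (Fin 2) (FreeSuperComm K)}
    (h : PS (a * b - b * a)) : PS (b * a - a * b) := by
  rw [← neg_sub]
  exact PS_neg h

lemma PS_comm {a b : Matrix (Fin 2) (Fin 2) (FreeSuperComm K)} (ha : a ∈ Falg K)
    (hb : b ∈ Falg K) : PS (a * b - b * a) := by
  have z : ∀ c : Matrix (Fin 2) (Fin 2) (FreeSuperComm K), PS (c * c - c * c) := by
    intro c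
    rw [sub_self]
    exact PS_zero
  exact PS_comm_left (PS_swap (PS_comm_left (z _) (PS_swap PS_gen) hb))
    (PS_swap (PS_comm_left PS_gen (z _) hb)) ha

end helpers

/- STATEMENT 1: [t1,t2][t3,t4][t5,t6] is a polynomial identity of F. -/
theorem stmt1 (K : Type*) [Field K] [CharZero K]
    (a₁ a₂ a₃ a₄ a₅ a₆ : Matrix (Fin 2) (Fin 2) (FreeSuperComm K))
    (h₁ : a₁ ∈ Falg K) (h₂ : a₂ ∈ Falg K) (h₃ : a₃ ∈ Falg K)
    (h₄ : a₄ ∈ Falg K) (h₅ : a₅ ∈ Falg K) (h₆ : a₆ ∈ Falg K) :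
    (a₁ * a₂ - a₂ * a₁) * (a₃ * a₄ - a₄ * a₃) * (a₅ * a₆ - a₆ * a₅) = 0 := by
  exact PS3 (PS_comm h₁ h₂) (PS_comm h₃ h₄) (PS_comm h₅ h₆)
end
end

section
/- The polynomial [t1,t2]^2 is not a central polynomial of M11(E): there exist elements a, b, c in M11(E) such that [[a,b]^2, c] is not zero. -/
noncomputable section

open CliffordAlgebra

/-- The Grassmann algebra of an infinite-dimensional vector space (free on countably many
generators); its even part is `evenOdd 0 0` and its odd part is `evenOdd 0 1`. -/
abbrev GrassmannAlg (K : Type*) [Field K] := ExteriorAlgebra K (ℕ →₀ K)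

/-- `M11(E)`: the subalgebra of 2×2 matrices over the Grassmann algebra `E` whose diagonal
entries are even and whose off-diagonal entries are odd. -/
def M11 (K : Type*) [Field K] :
    Subalgebra K (Matrix (Fin 2) (Fin 2) (GrassmannAlg K)) where
  carrier := {A | A 0 0 ∈ evenOdd (0 : QuadraticForm K (ℕ →₀ K)) 0 ∧
                  A 1 1 ∈ evenOdd (0 : QuadraticForm K (ℕ →₀ K)) 0 ∧
                  A 0 1 ∈ evenOdd (0 : QuadraticForm K (ℕ →₀ K)) 1 ∧
                  A 1 0 ∈ evenOdd (0 : QuadraticForm K (ℕ →₀ K)) 1}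
  add_mem' := by
    rintro A B ⟨h1, h2, h3, h4⟩ ⟨g1, g2, g3, g4⟩
    exact ⟨add_mem h1 g1, add_mem h2 g2, add_mem h3 g3, add_mem h4 g4⟩
  mul_mem' := by
    rintro A B ⟨h1, h2, h3, h4⟩ ⟨g1, g2, g3, g4⟩
    have e00 : ((0 : ZMod 2) + 0) = 0 := by decide
    have e11 : ((1 : ZMod 2) + 1) = 0 := by decide
    have e01 : ((0 : ZMod 2) + 1) = 1 := by decide
    have e10 : ((1 : ZMod 2) + 0) = 1 := by decide
    refine ⟨?_, ?_, ?_, ?_⟩ <;>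
      simp only [Set.mem_setOf_eq, Matrix.mul_apply, Fin.sum_univ_two]
    · exact add_mem (e00 ▸ SetLike.mul_mem_graded h1 g1)
        (e11 ▸ SetLike.mul_mem_graded h3 g4)
    · exact add_mem (e11 ▸ SetLike.mul_mem_graded h4 g3)
        (e00 ▸ SetLike.mul_mem_graded h2 g2)
    · exact add_mem (e01 ▸ SetLike.mul_mem_graded h1 g3)
        (e10 ▸ SetLike.mul_mem_graded h3 g2)
    · exact add_mem (e10 ▸ SetLike.mul_mem_graded h4 g1)
        (e01 ▸ SetLike.mul_mem_graded h2 g4)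
  algebraMap_mem' := by
    intro r
    refine ⟨?_, ?_, ?_, ?_⟩ <;>
      simp only [Set.mem_setOf_eq, Matrix.algebraMap_matrix_apply]
    · simpa using SetLike.algebraMap_mem_graded (evenOdd (0 : QuadraticForm K (ℕ →₀ K))) r
    · simpa using SetLike.algebraMap_mem_graded (evenOdd (0 : QuadraticForm K (ℕ →₀ K))) r
    · simp [zero_mem (evenOdd (0 : QuadraticForm K (ℕ →₀ K)) 1)]
    · simp [zero_mem (evenOdd (0 : QuadraticForm K (ℕ →₀ K)) 1)]

/-- `adIter c l z` is the left-normed commutator `[z, c, c, ..., c]` with `l` occurrences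
of `c`; so `adIter a l [a,b] = [a, b, a^(l)]`. -/
def adIter {A : Type*} [Ring A] (c : A) (l : ℕ) (z : A) : A :=
  (fun w => w * c - c * w)^[l] z

/- STATEMENT 4: [t1,t2]^2 is not a central polynomial of M11(E). -/
theorem stmt4 (K : Type*) [Field K] [CharZero K] :
    ∃ a b c : Matrix (Fin 2) (Fin 2) (GrassmannAlg K),
      a ∈ M11 K ∧ b ∈ M11 K ∧ c ∈ M11 K ∧
      (a * b - b * a) ^ 2 * c - c * ((a * b - b * a) ^ 2) ≠ 0 := by
  let Q : QuadraticForm K (ℕ →₀ K) := 0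
  let e : ℕ → CliffordAlgebra Q := fun i => CliffordAlgebra.ι Q (Finsupp.single i 1)
  have h1 : (1 : CliffordAlgebra Q) ∈ evenOdd Q 0 := SetLike.one_mem_graded (evenOdd Q)
  have he : ∀ i, e i ∈ evenOdd Q 1 := fun i => ι_mem_evenOdd_one Q _
  refine ⟨(!![1, 0; 0, 0] : Matrix (Fin 2) (Fin 2) (CliffordAlgebra Q)),
    (!![0, e 0; e 1, 0] : Matrix (Fin 2) (Fin 2) (CliffordAlgebra Q)),
    (!![0, e 2; 0, 0] : Matrix (Fin 2) (Fin 2) (CliffordAlgebra Q)),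
    ⟨h1, zero_mem _, zero_mem _, zero_mem _⟩,
    ⟨zero_mem _, zero_mem _, he 0, he 1⟩,
    ⟨zero_mem _, zero_mem _, he 2, zero_mem _⟩, ?_⟩
  intro h
  have h01 : - (e 0 * (e 1 * e 2)) + e 2 * (e 1 * e 0) = 0 := by
    have := congrFun (congrFun h 0) 1
    simpa [pow_two, Matrix.mul_apply, Fin.sum_univ_two, mul_assoc] using this
  have h2 := congrArg (fun z => contractLeft (Q := Q) (Finsupp.lapply 2)
    (contractLeft (Q := Q) (Finsupp.lapply 1)
      (contractLeft (Q := Q) (Finsupp.lapply (R := K) (M := K) 0) z))) h01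
  simp [e, contractLeft_ι_mul, contractLeft_ι] at h2
  have h3 : algebraMap K (CliffordAlgebra Q) 2 = 0 := by
    simp only [map_ofNat]
    rw [← neg_eq_zero, ← h2]; norm_num
  have := congrArg (ExteriorAlgebra.algebraMapInv (R := K) (M := ℕ →₀ K)) h3
  have h4 := (ExteriorAlgebra.algebraMap_leftInverse (R := K) (ℕ →₀ K)) 2
  exact two_ne_zero (h4.symm.trans (this.trans (map_zero _)))
end
end
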